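/- Let (C, μ) be a flat-foldable MV pattern. Then there is a finite sequence of operations, each of which is either a monocrimp at an adjacent pair of creases of opposite μ-value whose neighboring intervals are at least as long (with the induced assignment on the result), or an end fold at the first crease (allowed when the first interval is at most as long as the second) or at the last crease (allowed when the last interval is at most as long as the second-to-last), that reduces (C, μ) to a crease pattern with no creases. -/

import Mathlib

/-- Mountain or valley label for a crease. -/
inductive MV : Type
  | M : MV
  | V : MV
deriving DecidableEq

/-- `(c 0, c 1, …, c n)` is a 1D crease pattern: a strictly increasing finite
sequence of reals with `n ≥ 1`.  The points `c 1, …, c (n-1)` are its creases,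
`c 0` and `c n` its ends. -/
def IsCreasePattern (n : ℕ) (c : ℕ → ℝ) : Prop :=
  1 ≤ n ∧ ∀ i j : ℕ, i < j → j ≤ n → c i < c j

/-- The consecutive creases `(c i, …, c (i+k))` form a crimpable sequence with gap `d`. -/
def IsCrimpable (n : ℕ) (c : ℕ → ℝ) (i k : ℕ) (d : ℝ) : Prop :=
  1 ≤ i ∧ 1 ≤ k ∧ i + k ≤ n - 1 ∧
  (∀ m : ℕ, i ≤ m → m < i + k → c (m + 1) - c m = d) ∧
  d < c i - c (i - 1) ∧ d < c (i + k + 1) - c (i + k)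

/-- Additive offset of the folded-position map on the `j`-th interval:
on `[c j, c (j+1)]` the folded-position map is `x ↦ (-1)^j * x + foldOffset c j`. -/
def foldOffset (c : ℕ → ℝ) : ℕ → ℝ
  | 0 => 0
  | j + 1 => foldOffset c (j) + 2 * (-1 : ℝ) ^ j * c (j + 1)

/-- Folded position of a point `x` belonging to the `j`-th interval `[c j, c (j+1)]`.
This is the unique continuous map equal to the identity on `[c 0, c 1]`, isometric on
every interval, and reversing direction at every crease. -/
def foldPos (c : ℕ → ℝ) (j : ℕ) (x : ℝ) : ℝ := (-1 : ℝ) ^ j * x + foldOffset c j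

/-- Folded position of the crease `c i`. -/
def foldCrease (c : ℕ → ℝ) (i : ℕ) : ℝ := foldPos c i (c i)

/-- `x` lies strictly `lt`-between `a` and `b`. -/
def Between (lt : ℕ → ℕ → Prop) (a b x : ℕ) : Prop :=
  (lt a x ∧ lt x b) ∨ (lt b x ∧ lt x a)

/-- The MV pattern `(C, μ)` is flat-foldable: there is a strict linear order `lt`
("strictly below") on the intervals `I_0, …, I_{n-1}` (indexed `0, …, n-1`) such that:
(i) for each crease `i`, `I_{i-1}` is below `I_i` iff either `μ i = V` and the folded map
is increasing on `I_{i-1}` (slope `(-1)^(i-1) = 1`), or `μ i = M` and it is decreasing;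
(ii) for each crease `i` and each interval `J` whose folded image contains the folded
crease position in its interior, `J` is not strictly between `I_{i-1}` and `I_i`;
(iii) for distinct creases `i, j` folding to the same point, it is not the case that
exactly one of `I_{j-1}`, `I_j` is strictly between `I_{i-1}` and `I_i`. -/
def IsFlatFoldable (n : ℕ) (c : ℕ → ℝ) (μ : ℕ → MV) : Prop :=
  ∃ lt : ℕ → ℕ → Prop,
    (∀ j, j < n → ¬ lt j j) ∧
    (∀ a b e, lt a b → lt b e → lt a e) ∧
    (∀ a b, a < n → b < n → a ≠ b → lt a b ∨ lt b a) ∧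
    (∀ a b, lt a b → a < n ∧ b < n) ∧
    (∀ i, 1 ≤ i → i ≤ n - 1 →
      (lt (i - 1) i ↔ ((μ i = MV.V ∧ Even (i - 1)) ∨ (μ i = MV.M ∧ Odd (i - 1))))) ∧
    (∀ i, 1 ≤ i → i ≤ n - 1 → ∀ j, j < n →
      foldCrease c i ∈
        Set.Ioo (min (foldPos c j (c j)) (foldPos c j (c (j + 1))))
                (max (foldPos c j (c j)) (foldPos c j (c (j + 1)))) →
      ¬ Between lt (i - 1) i j) ∧
    (∀ i j, 1 ≤ i → i ≤ n - 1 → 1 ≤ j → j ≤ n - 1 → i ≠ j →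
      foldCrease c i = foldCrease c j →
      (Between lt (i - 1) i (j - 1) ↔ Between lt (i - 1) i j))

/-- `F` is a forcing set for the MV pattern `(C, μ)`: a set of creases such that the only
flat-foldable assignment agreeing with `μ` on `F` is `μ` itself (on all creases). -/
def IsForcingSet (n : ℕ) (c : ℕ → ℝ) (μ : ℕ → MV) (F : Set ℕ) : Prop :=
  F ⊆ Set.Icc 1 (n - 1) ∧
  ∀ ν : ℕ → MV, IsFlatFoldable n c ν → (∀ x ∈ F, ν x = μ x) →
    ∀ x, 1 ≤ x → x ≤ n - 1 → ν x = μ x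

/-- The crease pattern produced by a monocrimp at the adjacent pair `(c j, c (j+1))`:
it deletes `c j` and `c (j+1)` and translates all later points by `-2 * (c (j+1) - c j)`. -/
def monocrimpPattern (c : ℕ → ℝ) (j : ℕ) : ℕ → ℝ :=
  fun x => if x < j then c x else c (x + 2) - 2 * (c (j + 1) - c j)

/-- A single reduction step on an MV pattern `(n, c, μ)`: either a monocrimp at an
adjacent pair of creases of opposite μ-value whose neighboring intervals are at least
as long as the middle one, or an end fold at the first crease (allowed when the first
interval is at most as long as the second), or an end fold at the last crease (allowed
when the last interval is at most as long as the second-to-last). -/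
inductive FoldStep : ℕ × (ℕ → ℝ) × (ℕ → MV) → ℕ × (ℕ → ℝ) × (ℕ → MV) → Prop
  | mono (n : ℕ) (c : ℕ → ℝ) (μ : ℕ → MV) (j : ℕ)
      (h1 : 1 ≤ j) (h2 : j + 1 ≤ n - 1)
      (h3 : c (j + 1) - c j ≤ c j - c (j - 1))
      (h4 : c (j + 1) - c j ≤ c (j + 2) - c (j + 1))
      (h5 : μ j ≠ μ (j + 1)) :
      FoldStep (n, c, μ)
        (n - 2, monocrimpPattern c j, fun x => if x < j then μ x else μ (x + 2))
  | endLeft (n : ℕ) (c : ℕ → ℝ) (μ : ℕ → MV)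
      (h1 : 2 ≤ n) (h2 : c 1 - c 0 ≤ c 2 - c 1) :
      FoldStep (n, c, μ)
        (n - 1, fun x => if x = 0 then 2 * c 1 - c 0 else c (x + 1), fun x => μ (x + 1))
  | endRight (n : ℕ) (c : ℕ → ℝ) (μ : ℕ → MV)
      (h1 : 2 ≤ n) (h2 : c n - c (n - 1) ≤ c (n - 1) - c (n - 2)) :
      FoldStep (n, c, μ)
        (n - 1, fun x => if x = n - 1 then 2 * c (n - 1) - c n else c x, μ)


/-- `x` has rank strictly between the ranks of `a` and `b`. -/
def RankBetween (r : ℕ → ℤ) (a b x : ℕ) : Prop :=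
  (r a < r x ∧ r x < r b) ∨ (r b < r x ∧ r x < r a)

/-- Data of a monocrimp seen on the line: three consecutive layers `A`, `B`, `D` (images
`[lo, hi]`, heights `r`) forming a zigzag, and a new height function `R` in which `A` and `D`
are merged, the layers strictly between them being distributed below (`key = 1`) or above
(`key = 3`) the merged layer. -/
structure CrimpOrder (n : ℕ) (lo hi : ℕ → ℝ) (r key R : ℕ → ℤ) (A B D : ℕ) (p q : ℝ) :
    Prop where
  pq : p < q
  loA : lo A ≤ p
  hiA : hi A = q
  loB : lo B = p
  hiB : hi B = q
  loD : lo D = p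
  hiD : q ≤ hi D
  AB : r A < r B
  BD : r B < r D
  keyA : key A = 2
  keyD : key D = 2
  cases : ∀ a < n, a ≠ A → a ≠ B → a ≠ D →
    (key a = 0 ∧ r a < r A) ∨ (key a = 4 ∧ r D < r a) ∨
    (key a = 1 ∧ r A < r a ∧ r a < r B ∧ q ≤ lo a) ∨
    (key a = 1 ∧ r B < r a ∧ r a < r D ∧ p ≤ lo a) ∨
    (key a = 3 ∧ r A < r a ∧ r a < r B ∧ hi a ≤ q) ∨
    (key a = 3 ∧ r B < r a ∧ r a < r D ∧ hi a ≤ p)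
  lex : ∀ a < n, ∀ b < n, a ≠ B → b ≠ B →
    (R a < R b ↔ key a < key b ∨ (key a = key b ∧ key a ≠ 2 ∧ r a < r b))

/-- Two layers joined by a crease at `x` that closes them on the right, different from the
crease of the crimp. -/
structure RightTaco (n : ℕ) (lo hi : ℕ → ℝ) (r : ℕ → ℤ) (A B D : ℕ) (q : ℝ) (a b : ℕ) (x : ℝ) :
    Prop where
  a_lt : a < n
  b_lt : b < n
  aA : a ≠ A
  aB : a ≠ B
  bA : b ≠ A
  bB : b ≠ B
  lo_a : lo a < x
  lo_b : lo b < x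
  hi_a : hi a = x
  hi_b : hi b = x
  cross : ∀ J, J = A ∨ J = B ∨ J = D → lo J < x → x < hi J → ¬ RankBetween r a b J
  taco : x = q → (RankBetween r A B a ↔ RankBetween r A B b)

namespace CrimpOrder

variable {n : ℕ} {lo hi : ℕ → ℝ} {r key R : ℕ → ℤ} {A B D : ℕ} {p q : ℝ}

/-- Heights are compared in the same way before and after the crimp near a point outside the
image of `B`. -/
lemma lt_iff_of_outside (h : CrimpOrder n lo hi r key R A B D p q) {x : ℝ} (hx : x ≤ p ∨ q < x)
    {u v : ℕ} (hu : u < n) (hv : v < n) (huB : u ≠ B) (hvB : v ≠ B)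
    (lu : lo u < x) (ru : x ≤ hi u) (lv : lo v < x) (rv : x ≤ hi v) :
    R u < R v ↔ r u < r v := by
  obtain ⟨pq, loA, hiA, loB, hiB, loD, hiD, AB, BD, keyA, keyD, cs, lex⟩ := h
  rw [lex u hu v hv huB hvB]
  have hu' := cs u hu
  have hv' := cs v hv
  grind

lemma lt_iff_of_notMem (h : CrimpOrder n lo hi r key R A B D p q) {x : ℝ} (hx : p < x)
    (hxq : x ≤ q)
    {u v : ℕ} (hu : u < n) (hv : v < n) (huB : u ≠ B) (hvB : v ≠ B)
    (huA : u ≠ A) (hvA : v ≠ A)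
    (lu : lo u < x) (ru : x ≤ hi u) (lv : lo v < x) (rv : x ≤ hi v)
    (hu' : ¬ (r A < r u ∧ r u < r B)) (hv' : ¬ (r A < r v ∧ r v < r B)) :
    R u < R v ↔ r u < r v := by
  obtain ⟨pq, loA, hiA, loB, hiB, loD, hiD, AB, BD, keyA, keyD, cs, lex⟩ := h
  rw [lex u hu v hv huB hvB]
  have hu' := cs u hu
  have hv' := cs v hv
  grind

lemma key_eq_three_iff (h : CrimpOrder n lo hi r key R A B D p q) {x : ℝ} (hx : p < x)
    (hxq : x ≤ q) {u : ℕ} (hu : u < n) (huB : u ≠ B)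
    (lu : lo u < x) (ru : x ≤ hi u) :
    key u = 3 ↔ (r A < r u ∧ r u < r B) := by
  obtain ⟨pq, loA, hiA, loB, hiB, loD, hiD, AB, BD, keyA, keyD, cs, lex⟩ := h
  have hu' := cs u hu
  grind

lemma pocket_iff (h : CrimpOrder n lo hi r key R A B D p q) {x : ℝ} (hx : p < x)
    (hxq : x ≤ q) {a b : ℕ} (t : RightTaco n lo hi r A B D q a b x) :
    (r A < r a ∧ r a < r B) ↔ (r A < r b ∧ r b < r B) := by
  obtain ⟨pq, loA, hiA, loB, hiB, loD, hiD, AB, BD, keyA, keyD, cs, lex⟩ := h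
  obtain ⟨a_lt, b_lt, aA, aB, bA, bB, lo_a, lo_b, hi_a, hi_b, cross, taco⟩ := t
  have h1 := cross A (Or.inl rfl)
  have h2 := cross B (Or.inr (Or.inl rfl))
  have ha := cs a a_lt
  have hb := cs b b_lt
  unfold RankBetween at *
  grind

lemma between_iff_of_mem (h : CrimpOrder n lo hi r key R A B D p q) {x : ℝ} (hx : p < x)
    (hxq : x ≤ q) {a b : ℕ} (t : RightTaco n lo hi r A B D q a b x)
    (ha : r A < r a ∧ r a < r B) {u : ℕ} (hu : u < n) (huB : u ≠ B)
    (lu : lo u < x) (ru : x ≤ hi u) :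
    RankBetween R a b u ↔ RankBetween r a b u := by
  have hb := (h.pocket_iff hx hxq t).1 ha
  have ka := (h.key_eq_three_iff hx hxq t.a_lt t.aB t.lo_a t.hi_a.ge).2 ha
  have kb := (h.key_eq_three_iff hx hxq t.b_lt t.bB t.lo_b t.hi_b.ge).2 hb
  have ku := h.key_eq_three_iff hx hxq hu huB lu ru
  have l1 := h.lex a t.a_lt u hu t.aB huB
  have l2 := h.lex u hu a t.a_lt huB t.aB
  have l3 := h.lex b t.b_lt u hu t.bB huB
  have l4 := h.lex u hu b t.b_lt huB t.bB
  unfold RankBetween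
  grind

theorem lt_iff_of_rightTaco (h : CrimpOrder n lo hi r key R A B D p q) {x : ℝ} {a b : ℕ}
    (t : RightTaco n lo hi r A B D q a b x) : R a < R b ↔ r a < r b := by
  rcases le_or_gt x p with hx | hx
  · exact h.lt_iff_of_outside (Or.inl hx) t.a_lt t.b_lt t.aB t.bB t.lo_a t.hi_a.ge t.lo_b t.hi_b.ge
  rcases lt_or_ge q x with hq | hq
  · exact h.lt_iff_of_outside (Or.inr hq) t.a_lt t.b_lt t.aB t.bB t.lo_a t.hi_a.ge t.lo_b t.hi_b.ge
  have hp := h.pocket_iff hx hq t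
  by_cases ha : r A < r a ∧ r a < r B
  · have ka := (h.key_eq_three_iff hx hq t.a_lt t.aB t.lo_a t.hi_a.ge).2 ha
    have kb := (h.key_eq_three_iff hx hq t.b_lt t.bB t.lo_b t.hi_b.ge).2 (hp.1 ha)
    have l1 := h.lex a t.a_lt b t.b_lt t.aB t.bB
    rw [l1, ka, kb]; simp
  · exact h.lt_iff_of_notMem hx hq t.a_lt t.b_lt t.aB t.bB t.aA t.bA t.lo_a t.hi_a.ge t.lo_b
      t.hi_b.ge ha (fun hb => ha (hp.2 hb))

theorem not_between_of_rightTaco (h : CrimpOrder n lo hi r key R A B D p q) {x : ℝ} {a b : ℕ}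
    (t : RightTaco n lo hi r A B D q a b x) {u : ℕ} (hu : u < n) (huB : u ≠ B)
    (lu : lo u < x) (ru : x < hi u) (hn : ¬ RankBetween r a b u)
    (hpocket : r A < r u → r u < r B → ¬ (lo u < q ∧ q < hi u)) :
    ¬ RankBetween R a b u := by
  by_cases hout : x ≤ p ∨ q < x
  · unfold RankBetween at *
    rwa [h.lt_iff_of_outside hout t.a_lt hu t.aB huB t.lo_a t.hi_a.ge lu ru.le,
      h.lt_iff_of_outside hout t.b_lt hu t.bB huB t.lo_b t.hi_b.ge lu ru.le,
      h.lt_iff_of_outside hout hu t.a_lt huB t.aB lu ru.le t.lo_a t.hi_a.ge,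
      h.lt_iff_of_outside hout hu t.b_lt huB t.bB lu ru.le t.lo_b t.hi_b.ge]
  push Not at hout
  obtain ⟨hx, hq⟩ := hout
  by_cases ha : r A < r a ∧ r a < r B
  · rwa [h.between_iff_of_mem hx hq t ha hu huB lu ru.le]
  have hb := fun hb => ha ((h.pocket_iff hx hq t).2 hb)
  by_cases hu' : (r A < r u ∧ r u < r B) ∨ u = A
  · have hxq : x < q := by
      rcases hu' with hu' | rfl
      · by_contra hc
        exact hpocket hu'.1 hu'.2 ⟨by linarith, by linarith⟩
      · rw [← h.hiA]; exact ru
    have l1 := h.lex a t.a_lt u hu t.aB huB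
    have l2 := h.lex u hu a t.a_lt huB t.aB
    have l3 := h.lex b t.b_lt u hu t.bB huB
    have l4 := h.lex u hu b t.b_lt huB t.bB
    have ku := h.key_eq_three_iff hx hq hu huB lu ru.le
    obtain ⟨a_lt, b_lt, aA, aB, bA, bB, lo_a, lo_b, hi_a, hi_b, cross, taco⟩ := t
    have h1 := cross D (Or.inr (Or.inr rfl))
    have h2 := cross A (Or.inl rfl)
    have h3 := cross B (Or.inr (Or.inl rfl))
    obtain ⟨pq, loA, hiA, loB, hiB, loD, hiD, AB, BD, keyA, keyD, cs, lex⟩ := h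
    have ca := cs a a_lt
    have cb := cs b b_lt
    clear cs lex cross
    unfold RankBetween at *
    grind
  · push Not at hu'
    unfold RankBetween at *
    have hu'' : ¬ (r A < r u ∧ r u < r B) := by have := hu'.1; grind
    rwa [h.lt_iff_of_notMem hx hq t.a_lt hu t.aB huB t.aA hu'.2 t.lo_a t.hi_a.ge lu ru.le ha hu'',
      h.lt_iff_of_notMem hx hq t.b_lt hu t.bB huB t.bA hu'.2 t.lo_b t.hi_b.ge lu ru.le hb hu'',
      h.lt_iff_of_notMem hx hq hu t.a_lt huB t.aB hu'.2 t.aA lu ru.le t.lo_a t.hi_a.ge hu'' ha,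
      h.lt_iff_of_notMem hx hq hu t.b_lt huB t.bB hu'.2 t.bA lu ru.le t.lo_b t.hi_b.ge hu'' hb]

theorem between_iff_of_rightTaco (h : CrimpOrder n lo hi r key R A B D p q) {x : ℝ}
    {a b u v : ℕ} (t : RightTaco n lo hi r A B D q a b x) (s : RightTaco n lo hi r A B D q u v x)
    (hn : RankBetween r a b u ↔ RankBetween r a b v) :
    RankBetween R a b u ↔ RankBetween R a b v := by
  by_cases hout : x ≤ p ∨ q < x
  · have key : ∀ w, w < n → w ≠ B → lo w < x → x ≤ hi w →
        (RankBetween R a b w ↔ RankBetween r a b w) := by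
      intro w hw hwB lw rw'
      unfold RankBetween
      rw [h.lt_iff_of_outside hout t.a_lt hw t.aB hwB t.lo_a t.hi_a.ge lw rw',
        h.lt_iff_of_outside hout t.b_lt hw t.bB hwB t.lo_b t.hi_b.ge lw rw',
        h.lt_iff_of_outside hout hw t.a_lt hwB t.aB lw rw' t.lo_a t.hi_a.ge,
        h.lt_iff_of_outside hout hw t.b_lt hwB t.bB lw rw' t.lo_b t.hi_b.ge]
    rw [key u s.a_lt s.aB s.lo_a s.hi_a.ge, key v s.b_lt s.bB s.lo_b s.hi_b.ge, hn]
  push Not at hout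
  obtain ⟨hx, hq⟩ := hout
  by_cases ha : r A < r a ∧ r a < r B
  · rw [h.between_iff_of_mem hx hq t ha s.a_lt s.aB s.lo_a s.hi_a.ge,
      h.between_iff_of_mem hx hq t ha s.b_lt s.bB s.lo_b s.hi_b.ge, hn]
  have hb := fun hb => ha ((h.pocket_iff hx hq t).2 hb)
  have huv := h.pocket_iff hx hq s
  by_cases hu : r A < r u ∧ r u < r B
  · have hv := huv.1 hu
    have ku := (h.key_eq_three_iff hx hq s.a_lt s.aB s.lo_a s.hi_a.ge).2 hu
    have kv := (h.key_eq_three_iff hx hq s.b_lt s.bB s.lo_b s.hi_b.ge).2 hv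
    have ka := (h.key_eq_three_iff hx hq t.a_lt t.aB t.lo_a t.hi_a.ge).not.2 ha
    have kb := (h.key_eq_three_iff hx hq t.b_lt t.bB t.lo_b t.hi_b.ge).not.2 hb
    unfold RankBetween
    rw [h.lex a t.a_lt u s.a_lt t.aB s.aB, h.lex u s.a_lt a t.a_lt s.aB t.aB,
      h.lex b t.b_lt u s.a_lt t.bB s.aB, h.lex u s.a_lt b t.b_lt s.aB t.bB,
      h.lex a t.a_lt v s.b_lt t.aB s.bB, h.lex v s.b_lt a t.a_lt s.bB t.aB,
      h.lex b t.b_lt v s.b_lt t.bB s.bB, h.lex v s.b_lt b t.b_lt s.bB t.bB, ku, kv]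
    grind
  · have hv := fun hv => hu (huv.2 hv)
    have key : ∀ w, w < n → w ≠ A → w ≠ B → lo w < x → x ≤ hi w →
        ¬ (r A < r w ∧ r w < r B) → (RankBetween R a b w ↔ RankBetween r a b w) := by
      intro w hw hwA hwB lw rw' hw'
      unfold RankBetween
      rw [h.lt_iff_of_notMem hx hq t.a_lt hw t.aB hwB t.aA hwA t.lo_a t.hi_a.ge lw rw' ha hw',
        h.lt_iff_of_notMem hx hq t.b_lt hw t.bB hwB t.bA hwA t.lo_b t.hi_b.ge lw rw' hb hw',
        h.lt_iff_of_notMem hx hq hw t.a_lt hwB t.aB hwA t.aA lw rw' t.lo_a t.hi_a.ge hw' ha,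
        h.lt_iff_of_notMem hx hq hw t.b_lt hwB t.bB hwA t.bA lw rw' t.lo_b t.hi_b.ge hw' hb]
    rw [key u s.a_lt s.aA s.aB s.lo_a s.hi_a.ge hu, key v s.b_lt s.bA s.bB s.lo_b s.hi_b.ge hv, hn]

/-- Reflecting both the line and the heights exchanges the roles of `A` and `D`. -/
theorem reflect (h : CrimpOrder n lo hi r key R A B D p q) :
    CrimpOrder n (fun a => -hi a) (fun a => -lo a) (fun a => -r a) (fun a => 4 - key a)
      (fun a => -R a) D B A (-q) (-p) := by
  obtain ⟨pq, loA, hiA, loB, hiB, loD, hiD, AB, BD, keyA, keyD, cs, lex⟩ := h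
  refine ⟨by linarith, by linarith, by simpa, by simpa, by simpa, by simpa, by simpa, by simpa,
    by simpa, by simp [keyD], by simp [keyA], ?_, ?_⟩
  · intro a ha h1 h2 h3
    clear lex
    rcases cs a ha h3 h2 h1 with h | h | h | h | h | h <;> clear cs <;> grind
  · intro a ha b hb h1 h2
    have := lex b hb a ha h2 h1
    grind

end CrimpOrder

/-- `F` gives the folded positions of the points of a crease pattern with `n` intervals
(the parity of `e` fixes the orientation of the first interval), and `r` the heights of the
intervals, so that no interval crosses a crease and no two creases facing the same direction
interlock. -/
structure NonCrossing (n : ℕ) (F : ℕ → ℝ) (e : ℕ) (r : ℕ → ℤ) : Prop where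
  up : ∀ i < n, (i + e) % 2 = 0 → F i < F (i + 1)
  down : ∀ i < n, (i + e) % 2 = 1 → F (i + 1) < F i
  inj : ∀ i < n, ∀ j < n, r i = r j → i = j
  cross : ∀ i j, i + 1 < n → j < n →
    (F j < F (i + 1) ∧ F (i + 1) < F (j + 1)) ∨ (F (j + 1) < F (i + 1) ∧ F (i + 1) < F j) →
    ¬ RankBetween r i (i + 1) j
  taco : ∀ i j, i + 1 < n → j + 1 < n → i % 2 = j % 2 → F (i + 1) = F (j + 1) →
    (RankBetween r i (i + 1) j ↔ RankBetween r i (i + 1) (j + 1))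

/-- `R` is a height function for the result of the monocrimp at the creases `j + 1`, `j + 2`,
indexed by the old intervals, with `j` and `j + 2` merged and `j + 1` to be ignored. -/
structure CrimpRank (n : ℕ) (F : ℕ → ℝ) (r : ℕ → ℤ) (j : ℕ) (R : ℕ → ℤ) : Prop where
  merge : R j = R (j + 2)
  inj : ∀ a < n, ∀ b < n, a ≠ j + 1 → b ≠ j + 1 → R a = R b →
    a = b ∨ (a = j ∧ b = j + 2) ∨ (a = j + 2 ∧ b = j)
  sign : ∀ i, i + 1 < n → i ≠ j → i ≠ j + 1 → (R i < R (i + 1) ↔ r i < r (i + 1))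
  cross : ∀ i k, i + 1 < n → k < n → i ≠ j → i ≠ j + 1 → k ≠ j + 1 →
    (F k < F (i + 1) ∧ F (i + 1) < F (k + 1)) ∨ (F (k + 1) < F (i + 1) ∧ F (i + 1) < F k) →
    ¬ RankBetween R i (i + 1) k
  taco : ∀ i k, i + 1 < n → k + 1 < n → i ≠ j → i ≠ j + 1 → k ≠ j → k ≠ j + 1 →
    i % 2 = k % 2 → F (i + 1) = F (k + 1) →
    (RankBetween R i (i + 1) k ↔ RankBetween R i (i + 1) (k + 1))

lemma rankBetween_neg (r : ℕ → ℤ) (a b x : ℕ) :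
    RankBetween (fun i => -r i) a b x ↔ RankBetween r a b x := by
  simp only [RankBetween]; omega

namespace NonCrossing

variable {n : ℕ} {F : ℕ → ℝ} {e : ℕ} {r : ℕ → ℤ}

lemma neg_rank (h : NonCrossing n F e r) : NonCrossing n F e (fun i => -r i) := by
  obtain ⟨up, down, inj, cross, taco⟩ := h
  refine ⟨up, down, fun i hi j hj hij => inj i hi j hj (by simpa using hij), ?_, ?_⟩
  · intro i j hi hj hc
    rw [rankBetween_neg]
    exact cross i j hi hj hc
  · intro i j hi hj hp hc
    rw [rankBetween_neg, rankBetween_neg]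
    exact taco i j hi hj hp hc

lemma neg_pos (h : NonCrossing n F e r) : NonCrossing n (fun i => -F i) (e + 1) r := by
  obtain ⟨up, down, inj, cross, taco⟩ := h
  refine ⟨fun i hi hp => ?_, fun i hi hp => ?_, inj, ?_, ?_⟩
  · have := down i hi (by omega)
    simpa
  · have := up i hi (by omega)
    simpa
  · intro i j hi hj hc
    refine cross i j hi hj ?_
    simp only [neg_lt_neg_iff] at hc
    tauto
  · intro i j hi hj hp hc
    exact taco i j hi hj hp (by simpa using hc)

end NonCrossing

lemma CrimpRank.neg_rank {n : ℕ} {F : ℕ → ℝ} {r : ℕ → ℤ} {j : ℕ} {R : ℕ → ℤ}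
    (h : CrimpRank n F (fun i => -r i) j R)
    (inj : ∀ i < n, ∀ j < n, r i = r j → i = j) :
    CrimpRank n F r j (fun i => -R i) := by
  obtain ⟨merge, inj', sign, cross, taco⟩ := h
  refine ⟨by simpa, fun a ha b hb h1 h2 h3 => inj' a ha b hb h1 h2 (by simpa using h3), ?_, ?_, ?_⟩
  · intro i hi h1 h2
    have h3 := sign i hi h1 h2
    have h4 := inj i (by omega) (i + 1) hi
    have h5 := inj' i (by omega) (i + 1) hi (by omega) (by omega)
    omega
  · intro i k hi hk h1 h2 h3 hc
    rw [rankBetween_neg]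
    exact cross i k hi hk h1 h2 h3 hc
  · intro i k hi hk h1 h2 h3 h4 hp hc
    rw [rankBetween_neg, rankBetween_neg]
    exact taco i k hi hk h1 h2 h3 h4 hp hc

lemma CrimpRank.of_neg_pos {n : ℕ} {F : ℕ → ℝ} {r : ℕ → ℤ} {j : ℕ} {R : ℕ → ℤ}
    (h : CrimpRank n (fun i => -F i) r j R) : CrimpRank n F r j R := by
  obtain ⟨merge, inj', sign, cross, taco⟩ := h
  refine ⟨merge, inj', sign, ?_, ?_⟩
  · intro i k hi hk h1 h2 h3 hc
    refine cross i k hi hk h1 h2 h3 ?_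
    simp only [neg_lt_neg_iff]
    tauto
  · intro i k hi hk h1 h2 h3 h4 hp hc
    exact taco i k hi hk h1 h2 h3 h4 hp (by simpa using hc)

namespace NonCrossing

variable {n : ℕ} {F : ℕ → ℝ} {e : ℕ} {r : ℕ → ℤ}

theorem exists_crimpOrder (h : NonCrossing n F e r) {j : ℕ} (hj : j + 2 < n)
    (he : (j + e) % 2 = 0) (hl : F j ≤ F (j + 2)) (hr : F (j + 1) ≤ F (j + 3))
    (h01 : r j < r (j + 1)) (h12 : r (j + 1) < r (j + 2)) :
    ∃ key R : ℕ → ℤ, CrimpOrder n (fun i => min (F i) (F (i + 1))) (fun i => max (F i) (F (i + 1)))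
      r key R j (j + 1) (j + 2) (F (j + 2)) (F (j + 1)) ∧ R j = R (j + 2) ∧
      ∀ a < n, ∀ b < n, a ≠ j + 1 → b ≠ j + 1 → R a = R b →
        a = b ∨ (a = j ∧ b = j + 2) ∨ (a = j + 2 ∧ b = j) := by
  classical
  obtain ⟨K, hK⟩ : ∃ K : ℤ, ∀ a < n, |r a| ≤ K := by
    refine ⟨∑ a ∈ Finset.range n, |r a|, fun a ha => ?_⟩
    exact Finset.single_le_sum (f := fun a => |r a|) (fun i _ => abs_nonneg _)
      (Finset.mem_range.2 ha)
  have u0 := h.up j (by omega) he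
  have u1 := h.down (j + 1) (by omega) (by omega)
  have u2 := h.up (j + 2) (by omega) (by omega)
  let lo : ℕ → ℝ := fun i => min (F i) (F (i + 1))
  obtain ⟨key, hkey⟩ : ∃ key : ℕ → ℤ, ∀ a, key a = if r a < r j then 0 else
      if r (j + 2) < r a then 4 else if a = j ∨ a = j + 2 then 2 else
      if (r (j + 1) < r a ∧ F (j + 2) ≤ lo a) ∨ (r a < r (j + 1) ∧ F (j + 1) ≤ lo a) then 1
      else 3 := ⟨_, fun a => rfl⟩
  obtain ⟨R, hR⟩ : ∃ R : ℕ → ℤ, ∀ a, R a = key a * (2 * K + 1) +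
      if a = j ∨ a = j + 2 then 0 else r a := ⟨_, fun a => rfl⟩
  have kA : key j = 2 := by
    rw [hkey, if_neg (lt_irrefl _), if_neg (by omega), if_pos (Or.inl rfl)]
  have kD : key (j + 2) = 2 := by
    rw [hkey, if_neg (by omega), if_neg (lt_irrefl _), if_pos (Or.inr rfl)]
  have hcases : ∀ a < n, a ≠ j → a ≠ j + 1 → a ≠ j + 2 →
      (key a = 0 ∧ r a < r j) ∨ (key a = 4 ∧ r (j + 2) < r a) ∨
      (key a = 1 ∧ r j < r a ∧ r a < r (j + 1) ∧ F (j + 1) ≤ lo a) ∨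
      (key a = 1 ∧ r (j + 1) < r a ∧ r a < r (j + 2) ∧ F (j + 2) ≤ lo a) ∨
      (key a = 3 ∧ r j < r a ∧ r a < r (j + 1) ∧ max (F a) (F (a + 1)) ≤ F (j + 1)) ∨
      (key a = 3 ∧ r (j + 1) < r a ∧ r a < r (j + 2) ∧ max (F a) (F (a + 1)) ≤ F (j + 2)) := by
    intro a ha h0 h1 h2
    have n0 := mt (h.inj a ha j (by omega)) h0
    have n1 := mt (h.inj a ha (j + 1) (by omega)) h1
    have n2 := mt (h.inj a ha (j + 2) (by omega)) h2
    have c1 := h.cross j a (by omega) ha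
    have c2 := h.cross (j + 1) a (by omega) ha
    have hka := hkey a
    have hn : ¬ (a = j ∨ a = j + 2) := by omega
    rw [if_neg hn] at hka
    simp only [lo, le_min_iff, max_le_iff] at hka ⊢
    unfold RankBetween at c1 c2
    split_ifs at hka with g1 g2 g3
    · exact Or.inl ⟨hka, g1⟩
    · exact Or.inr (Or.inl ⟨hka, g2⟩)
    · rcases g3 with g3 | g3
      · exact Or.inr (Or.inr (Or.inr (Or.inl ⟨hka, g3.1, by omega, g3.2⟩)))
      · exact Or.inr (Or.inr (Or.inl ⟨hka, by omega, g3.1, g3.2⟩))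
    · rcases lt_or_gt_of_ne n1 with g | g
      · refine Or.inr (Or.inr (Or.inr (Or.inr (Or.inl ⟨hka, by omega, g, ?_⟩))))
        grind
      · refine Or.inr (Or.inr (Or.inr (Or.inr (Or.inr ⟨hka, g, by omega, ?_⟩))))
        grind
  have hkr : ∀ a < n, a ≠ j + 1 → (a = j ∨ a = j + 2) ∧ key a = 2 ∨
      ¬ (a = j ∨ a = j + 2) ∧ (key a = 0 ∨ key a = 1 ∨ key a = 3 ∨ key a = 4) := by
    intro a ha h1
    by_cases h0 : a = j
    · subst h0; exact Or.inl ⟨Or.inl rfl, kA⟩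
    by_cases h2 : a = j + 2
    · subst h2; exact Or.inl ⟨Or.inr rfl, kD⟩
    have := hcases a ha h0 h1 h2
    right
    refine ⟨by omega, ?_⟩
    rcases this with h | h | h | h | h | h <;> simp [h.1]
  refine ⟨key, R, ⟨u1, ?_, ?_, ?_, ?_, ?_, ?_, h01, h12, kA, kD, hcases, ?_⟩, ?_, ?_⟩
  · exact (min_le_left _ _).trans hl
  · exact max_eq_right u0.le
  · exact min_eq_right u1.le
  · exact max_eq_left u1.le
  · exact min_eq_left u2.le
  · exact hr.trans (le_max_right _ _)
  · intro a ha b hb h1 h2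
    have ka := abs_le.1 (hK a ha)
    have kb := abs_le.1 (hK b hb)
    rw [hR a, hR b]
    rcases hkr a ha h1 with ⟨g, k⟩ | ⟨g, k | k | k | k⟩ <;>
      rcases hkr b hb h2 with ⟨g', k'⟩ | ⟨g', k' | k' | k' | k'⟩ <;>
      simp only [g, g', k, k', if_true, if_false, true_and] <;> omega
  · rw [hR, hR, kA, kD]; simp
  · intro a ha b hb h1 h2 hab
    have ka := abs_le.1 (hK a ha)
    have kb := abs_le.1 (hK b hb)
    have hi : r a ≠ r b ∨ a = b := by
      by_cases hc : r a = r b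
      · exact Or.inr (h.inj a ha b hb hc)
      · exact Or.inl hc
    rw [hR a, hR b] at hab
    rcases hkr a ha h1 with ⟨g, k⟩ | ⟨g, k | k | k | k⟩ <;>
      rcases hkr b hb h2 with ⟨g', k'⟩ | ⟨g', k' | k' | k' | k'⟩ <;>
      simp only [g, g', k, k', if_true, if_false] at hab <;> omega

lemma rightTaco (h : NonCrossing n F e r) {j : ℕ} (hj : j + 2 < n)
    (he : (j + e) % 2 = 0) {i : ℕ} (hi : i + 1 < n) (hp : (i + e) % 2 = 0) (hij : i ≠ j) :
    RightTaco n (fun i => min (F i) (F (i + 1))) (fun i => max (F i) (F (i + 1)))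
      r j (j + 1) (j + 2) (F (j + 1)) i (i + 1) (F (i + 1)) := by
  have u1 := h.up i (by omega) hp
  have u2 := h.down (i + 1) (by omega) (by omega)
  refine ⟨by omega, hi, hij, by omega, by omega, by omega, ?_, ?_, ?_, ?_, ?_, ?_⟩
  · exact min_lt_of_left_lt u1
  · exact min_lt_of_right_lt u2
  · exact max_eq_right u1.le
  · exact max_eq_left u2.le
  · intro J hJ l1 l2
    refine h.cross i J hi (by omega) ?_
    grind
  · intro hx
    exact h.taco j i (by omega) hi (by omega) hx.symm

lemma leftTaco (h : NonCrossing n F e r) {j : ℕ} (hj : j + 2 < n)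
    (he : (j + e) % 2 = 0) {i : ℕ} (hi : i + 1 < n) (hp : (i + e) % 2 = 1) (hij : i ≠ j + 1) :
    RightTaco n (fun i => -max (F i) (F (i + 1))) (fun i => -min (F i) (F (i + 1)))
      (fun i => -r i) (j + 2) (j + 1) j (-F (j + 2)) i (i + 1) (-F (i + 1)) := by
  have u1 := h.down i (by omega) hp
  have u2 := h.up (i + 1) (by omega) (by omega)
  refine ⟨by omega, hi, by omega, by omega, by omega, by omega, ?_, ?_, ?_, ?_, ?_, ?_⟩
  · exact neg_lt_neg (lt_max_of_lt_left u1)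
  · exact neg_lt_neg (lt_max_of_lt_right u2)
  · exact congrArg _ (min_eq_right u1.le)
  · exact congrArg _ (min_eq_left u2.le)
  · intro J hJ l1 l2
    rw [rankBetween_neg]
    refine h.cross i J hi (by omega) ?_
    grind
  · intro hx
    rw [rankBetween_neg, rankBetween_neg]
    have := h.taco (j + 1) i (by omega) hi (by omega) (by simpa using hx.symm)
    unfold RankBetween at *
    tauto

theorem exists_crimpRank_of_lt (h : NonCrossing n F e r) {j : ℕ} (hj : j + 2 < n)
    (he : (j + e) % 2 = 0) (hl : F j ≤ F (j + 2)) (hr : F (j + 1) ≤ F (j + 3))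
    (h01 : r j < r (j + 1)) (h12 : r (j + 1) < r (j + 2)) :
    ∃ R : ℕ → ℤ, CrimpRank n F r j R := by
  obtain ⟨key, R, o, hm, hinj⟩ := h.exists_crimpOrder hj he hl hr h01 h12
  have o' := o.reflect
  refine ⟨R, hm, hinj, ?_, ?_, ?_⟩
  · intro i hi h0 h1
    rcases Nat.mod_two_eq_zero_or_one (i + e) with hp | hp
    · exact o.lt_iff_of_rightTaco (h.rightTaco hj he hi hp h0)
    · have := o'.lt_iff_of_rightTaco (h.leftTaco hj he hi hp h1)
      have h4 := h.inj i (by omega) (i + 1) hi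
      have h5 := hinj i (by omega) (i + 1) hi (by omega) (by omega)
      omega
  · intro i k hi hk h0 h1 hk1 hc
    have hn := h.cross i k hi hk hc
    rcases Nat.mod_two_eq_zero_or_one (i + e) with hp | hp
    · refine o.not_between_of_rightTaco (h.rightTaco hj he hi hp h0) hk hk1 ?_ ?_ hn ?_
      · grind
      · grind
      · intro g1 g2 g3
        exact h.cross j k (by omega) hk (by grind) (Or.inl ⟨g1, g2⟩)
    · have := o'.not_between_of_rightTaco (h.leftTaco hj he hi hp h1) hk hk1 (by grind) (by grind)
        (by rwa [rankBetween_neg]) ?_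
      · rwa [rankBetween_neg] at this
      · intro g1 g2 g3
        exact h.cross (j + 1) k (by omega) hk (by grind)
          (Or.inl ⟨by omega, show r k < r (j + 2) by omega⟩)
  · intro i k hi hk h0 h1 hk0 hk1 hp' hc
    have hn := h.taco i k hi hk hp' hc
    rcases Nat.mod_two_eq_zero_or_one (i + e) with hp | hp
    · have hs := h.rightTaco hj he hk (by omega) hk0
      rw [← hc] at hs
      exact o.between_iff_of_rightTaco (h.rightTaco hj he hi hp h0) hs hn
    · have hs := h.leftTaco hj he hk (by omega) hk1
      rw [← hc] at hs
      have := o'.between_iff_of_rightTaco (h.leftTaco hj he hi hp h1) hs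
        (by rwa [rankBetween_neg, rankBetween_neg])
      rwa [rankBetween_neg, rankBetween_neg] at this

theorem exists_crimpRank_of_even (h : NonCrossing n F e r) {j : ℕ} (hj : j + 2 < n)
    (he : (j + e) % 2 = 0) (hl : F j ≤ F (j + 2)) (hr : F (j + 1) ≤ F (j + 3))
    (hs : r j < r (j + 1) ↔ r (j + 1) < r (j + 2)) :
    ∃ R : ℕ → ℤ, CrimpRank n F r j R := by
  by_cases h01 : r j < r (j + 1)
  · exact h.exists_crimpRank_of_lt hj he hl hr h01 (hs.1 h01)
  · have n1 := h.inj j (by omega) (j + 1) (by omega)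
    have n2 := h.inj (j + 1) (by omega) (j + 2) (by omega)
    obtain ⟨R, hR⟩ := h.neg_rank.exists_crimpRank_of_lt hj he hl hr (by omega) (by omega)
    exact ⟨_, hR.neg_rank h.inj⟩

theorem exists_crimpRank (h : NonCrossing n F e r) {j : ℕ} (hj : j + 2 < n)
    (hl : |F (j + 2) - F (j + 1)| ≤ |F (j + 1) - F j|)
    (hr : |F (j + 2) - F (j + 1)| ≤ |F (j + 3) - F (j + 2)|)
    (hs : r j < r (j + 1) ↔ r (j + 1) < r (j + 2)) :
    ∃ R : ℕ → ℤ, CrimpRank n F r j R := by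
  rcases Nat.mod_two_eq_zero_or_one (j + e) with he | he
  · have u0 := h.up j (by omega) he
    have u1 := h.down (j + 1) (by omega) (by omega)
    have u2 := h.up (j + 2) (by omega) (by omega)
    rw [abs_of_neg (by linarith), abs_of_pos (by linarith)] at hl hr
    exact h.exists_crimpRank_of_even hj he (by linarith) (by linarith) hs
  · have u0 := h.down j (by omega) he
    have u1 := h.up (j + 1) (by omega) (by omega)
    have u2 := h.down (j + 2) (by omega) (by omega)
    rw [abs_of_pos (by linarith), abs_of_neg (by linarith)] at hl hr
    obtain ⟨R, hR⟩ := h.neg_pos.exists_crimpRank_of_even hj (by omega) (by linarith)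
      (by linarith) hs
    exact ⟨R, hR.of_neg_pos⟩

end NonCrossing

/-- A flat folding of the MV pattern `(c, μ)` with `n` intervals: folded positions `F` and
heights `r` without crossings that realize the lengths and the MV assignment. -/
structure IsFolding (n : ℕ) (c : ℕ → ℝ) (μ : ℕ → MV) (F : ℕ → ℝ) (e : ℕ) (r : ℕ → ℤ) : Prop where
  nonCrossing : NonCrossing n F e r
  length : ∀ i < n, |F (i + 1) - F i| = c (i + 1) - c i
  mv : ∀ i, i + 1 < n → (r i < r (i + 1) ↔ (μ (i + 1) = MV.V ↔ (i + e) % 2 = 0))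

theorem IsFlatFoldable.exists_isFolding {n : ℕ} {c : ℕ → ℝ} {μ : ℕ → MV}
    (hC : IsCreasePattern n c) (hF : IsFlatFoldable n c μ) :
    ∃ F e r, IsFolding n c μ F e r := by
  classical
  obtain ⟨lt, irr, tr, tot, dom, mv, cross, taco⟩ := hF
  let r : ℕ → ℤ := fun a => ((Finset.range n).filter (fun b => lt b a)).card
  have hlt : ∀ a b, lt a b → r a < r b := by
    intro a b hab
    simp only [r, Nat.cast_lt]
    apply Finset.card_lt_card
    refine ⟨fun x hx => ?_, fun hs => ?_⟩
    · simp only [Finset.mem_filter] at hx ⊢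
      exact ⟨hx.1, tr _ _ _ hx.2 hab⟩
    · have := hs (Finset.mem_filter.2 ⟨Finset.mem_range.2 (dom a b hab).1, hab⟩)
      exact irr a (dom a b hab).1 (Finset.mem_filter.1 this).2
  have hiff : ∀ a b, a < n → b < n → (lt a b ↔ r a < r b) := by
    intro a b ha hb
    refine ⟨hlt a b, fun h => ?_⟩
    by_cases hab : a = b
    · subst hab; exact absurd h (lt_irrefl _)
    · rcases tot a b ha hb hab with h' | h'
      · exact h'
      · exact absurd h (not_lt.2 (hlt b a h').le)
  have hbt : ∀ a b x, a < n → b < n → x < n → (Between lt a b x ↔ RankBetween r a b x) := by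
    intro a b x ha hb hx
    unfold Between RankBetween
    rw [hiff a x ha hx, hiff x b hx hb, hiff b x hb hx, hiff x a hx ha]
  have hpos : ∀ j, foldPos c j (c (j + 1)) = foldCrease c (j + 1) := by
    intro j
    simp only [foldCrease, foldPos, foldOffset, pow_succ]
    ring
  have hstep : ∀ j, foldCrease c (j + 1) - foldCrease c j = (-1) ^ j * (c (j + 1) - c j) := by
    intro j
    rw [← hpos]
    simp only [foldCrease, foldPos]
    ring
  have hc : ∀ i < n, c i < c (i + 1) := fun i hi => hC.2 i (i + 1) (by omega) (by omega)
  refine ⟨foldCrease c, 0, r, ⟨?_, ?_, ?_, ?_, ?_⟩, ?_, ?_⟩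
  · intro i hi he
    have := hstep i
    rw [Even.neg_one_pow (Nat.even_iff.2 (by simpa using he))] at this
    have := hc i hi
    linarith
  · intro i hi he
    have := hstep i
    rw [Odd.neg_one_pow (Nat.odd_iff.2 (by simpa using he))] at this
    have := hc i hi
    linarith
  · intro i hi j hj hij
    by_contra hne
    rcases tot i j hi hj hne with h | h
    · have := hlt _ _ h; omega
    · have := hlt _ _ h; omega
  · intro i j hi hj h
    have := cross (i + 1) (by omega) (by omega) j hj
    rw [hpos, Nat.add_sub_cancel, hbt _ _ _ (by omega) hi hj] at this
    apply this
    change foldCrease c (i + 1) ∈ Set.Ioo (min (foldCrease c j) _) (max (foldCrease c j) _)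
    rw [Set.mem_Ioo, min_lt_iff, lt_max_iff]
    rcases h with h | h
    · exact ⟨Or.inl h.1, Or.inr h.2⟩
    · exact ⟨Or.inr h.1, Or.inl h.2⟩
  · intro i j hi hj _ h
    by_cases hij : i = j
    · subst hij
      simp [RankBetween]
    have := taco (i + 1) (j + 1) (by omega) (by omega) (by omega) (by omega) (by omega) h
    rwa [Nat.add_sub_cancel, Nat.add_sub_cancel, hbt _ _ _ (by omega) hi (by omega),
      hbt _ _ _ (by omega) hi (by omega)] at this
  · intro i hi
    rw [hstep, abs_mul, abs_pow, abs_neg, abs_one, one_pow, one_mul, abs_of_pos]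
    linarith [hc i hi]
  · intro i hi
    have := mv (i + 1) (by omega) (by omega)
    rw [Nat.add_sub_cancel, hiff _ _ (by omega) hi] at this
    rw [this, ← Nat.not_even_iff_odd, Nat.even_iff, add_zero]
    cases μ (i + 1) <;> simp

namespace IsFolding

variable {n : ℕ} {c : ℕ → ℝ} {μ : ℕ → MV} {F : ℕ → ℝ} {e : ℕ} {r : ℕ → ℤ}

lemma lt_succ (h : IsFolding n c μ F e r) {i : ℕ} (hi : i < n) : c i < c (i + 1) := by
  have h1 := h.length i hi
  have h2 : 0 < |F (i + 1) - F i| := by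
    rw [abs_pos, sub_ne_zero]
    rcases Nat.mod_two_eq_zero_or_one (i + e) with he | he
    · exact (h.nonCrossing.up i hi he).ne'
    · exact (h.nonCrossing.down i hi he).ne
  linarith

/-- Removing the first interval. -/
lemma tail (h : IsFolding (n + 1) c μ F e r) :
    IsFolding n (fun i => c (i + 1)) (fun i => μ (i + 1)) (fun i => F (i + 1)) (e + 1)
      (fun i => r (i + 1)) := by
  obtain ⟨⟨up, down, inj, cross, taco⟩, len, mv⟩ := h
  refine ⟨⟨fun i hi he => up (i + 1) (by omega) (by omega),
    fun i hi he => down (i + 1) (by omega) (by omega),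
    fun i hi j hj hij => by have := inj (i + 1) (by omega) (j + 1) (by omega) hij; omega,
    fun i j hi hj hc => cross (i + 1) (j + 1) (by omega) (by omega) hc,
    fun i j hi hj hp hc => taco (i + 1) (j + 1) (by omega) (by omega) (by omega) hc⟩,
    fun i hi => len (i + 1) (by omega), fun i hi => ?_⟩
  rw [mv (i + 1) (by omega), show i + 1 + e = i + (e + 1) by ring]

/-- Removing the last interval. -/
lemma init (h : IsFolding (n + 1) c μ F e r) : IsFolding n c μ F e r := by
  obtain ⟨⟨up, down, inj, cross, taco⟩, len, mv⟩ := h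
  exact ⟨⟨fun i hi => up i (by omega), fun i hi => down i (by omega),
    fun i hi j hj => inj i (by omega) j (by omega),
    fun i j hi hj => cross i j (by omega) (by omega),
    fun i j hi hj => taco i j (by omega) (by omega)⟩,
    fun i hi => len i (by omega), fun i hi => mv i (by omega)⟩

/-- Moving the free end of the first interval closer to its crease. -/
lemma shorten_first (h : IsFolding n c μ F e r) {x y : ℝ}
    (hy : 0 < n → F 0 < F 1 → F 0 ≤ y ∧ y < F 1)
    (hy' : 0 < n → F 1 < F 0 → y ≤ F 0 ∧ F 1 < y)
    (hxy : |F 1 - y| = c 1 - x) :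
    IsFolding n (fun i => if i = 0 then x else c i) μ (fun i => if i = 0 then y else F i) e r := by
  obtain ⟨⟨up, down, inj, cross, taco⟩, len, mv⟩ := h
  refine ⟨⟨?_, ?_, inj, ?_, ?_⟩, ?_, mv⟩
  · intro i hi he
    have := up i hi he
    rcases Nat.eq_zero_or_pos i with rfl | h0
    · simpa using (hy hi this).2
    · simpa [h0.ne'] using this
  · intro i hi he
    have := down i hi he
    rcases Nat.eq_zero_or_pos i with rfl | h0
    · simpa using (hy' hi this).2
    · simpa [h0.ne'] using this
  · intro i j hi hj hc
    apply cross i j hi hj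
    rcases Nat.eq_zero_or_pos j with rfl | h0
    · simp only [if_true, Nat.add_eq_zero_iff, one_ne_zero, and_false, if_false, zero_add] at hc ⊢
      have h1 := up 0 hj
      have h2 := down 0 hj
      simp only [zero_add] at h1 h2
      rcases Nat.mod_two_eq_zero_or_one e with he | he
      · have := hy hj (h1 he)
        grind
      · have := hy' hj (h2 he)
        grind
    · simpa [h0.ne'] using hc
  · intro i j hi hj hp hc
    exact taco i j hi hj hp (by simpa using hc)
  · intro i hi
    rcases Nat.eq_zero_or_pos i with rfl | h0
    · simpa using hxy
    · simpa [h0.ne'] using len i hi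

/-- Moving the free end of the last interval closer to its crease. -/
lemma shorten_last (h : IsFolding (n + 1) c μ F e r) {x y : ℝ}
    (hy : F n < F (n + 1) → F n < y ∧ y ≤ F (n + 1))
    (hy' : F (n + 1) < F n → y < F n ∧ F (n + 1) ≤ y)
    (hxy : |y - F n| = x - c n) :
    IsFolding (n + 1) (fun i => if i = n + 1 then x else c i) μ
      (fun i => if i = n + 1 then y else F i) e r := by
  obtain ⟨⟨up, down, inj, cross, taco⟩, len, mv⟩ := h
  refine ⟨⟨?_, ?_, inj, ?_, ?_⟩, ?_, mv⟩
  · intro i hi he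
    have := up i hi he
    by_cases h0 : i = n
    · subst h0; simpa using (hy this).1
    · rwa [if_neg (show i + 1 ≠ n + 1 by omega), if_neg (show i ≠ n + 1 by omega)]
  · intro i hi he
    have := down i hi he
    by_cases h0 : i = n
    · subst h0; simpa using (hy' this).1
    · rwa [if_neg (show i + 1 ≠ n + 1 by omega), if_neg (show i ≠ n + 1 by omega)]
  · intro i j hi hj hc
    apply cross i j hi hj
    rw [if_neg (show i + 1 ≠ n + 1 by omega), if_neg (show j ≠ n + 1 by omega)] at hc
    by_cases h0 : j = n
    · subst h0
      rw [if_pos rfl] at hc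
      rcases Nat.mod_two_eq_zero_or_one (j + e) with he | he
      · have := hy (up j hj he)
        grind
      · have := hy' (down j hj he)
        grind
    · rwa [if_neg (by omega)] at hc
  · intro i j hi hj hp hc
    rw [if_neg (show i + 1 ≠ n + 1 by omega), if_neg (show j + 1 ≠ n + 1 by omega)] at hc
    exact taco i j hi hj hp hc
  · intro i hi
    have := len i hi
    by_cases h0 : i = n
    · subst h0; simpa using hxy
    · simpa [h0, show i ≠ n + 1 by omega] using this

lemma sub_eq_of_even (h : IsFolding n c μ F e r) {i : ℕ} (hi : i < n) (he : (i + e) % 2 = 0) :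
    F (i + 1) - F i = c (i + 1) - c i := by
  rw [← h.length i hi, abs_of_pos (by linarith [h.nonCrossing.up i hi he])]

lemma sub_eq_of_odd (h : IsFolding n c μ F e r) {i : ℕ} (hi : i < n) (he : (i + e) % 2 = 1) :
    F (i + 1) - F i = -(c (i + 1) - c i) := by
  rw [← h.length i hi, abs_of_neg (by linarith [h.nonCrossing.down i hi he])]
  ring

theorem endLeft (h : IsFolding (n + 2) c μ F e r) (hlt : c 1 - c 0 < c 2 - c 1) :
    IsFolding (n + 1) (fun x => if x = 0 then 2 * c 1 - c 0 else c (x + 1))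
      (fun x => μ (x + 1)) (fun x => if x = 0 then F 0 else F (x + 1)) (e + 1)
      (fun x => r (x + 1)) := by
  refine h.tail.shorten_first ?_ ?_ ?_
  all_goals
    simp only [Nat.reduceAdd]
    have h0 : c 0 < c 1 := h.lt_succ (by omega)
    rcases Nat.mod_two_eq_zero_or_one e with he | he
    · have e0 := h.sub_eq_of_even (i := 0) (by omega) (by omega)
      have e1 := h.sub_eq_of_odd (i := 1) (by omega) (by omega)
      simp only [Nat.reduceAdd] at e0 e1
      first
        | (intro _ _; constructor <;> linarith)
        | (rw [abs_of_neg] <;> linarith)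
    · have e0 := h.sub_eq_of_odd (i := 0) (by omega) (by omega)
      have e1 := h.sub_eq_of_even (i := 1) (by omega) (by omega)
      simp only [Nat.reduceAdd] at e0 e1
      first
        | (intro _ _; constructor <;> linarith)
        | (rw [abs_of_pos] <;> linarith)

theorem endRight (h : IsFolding (n + 2) c μ F e r)
    (hlt : c (n + 2) - c (n + 1) < c (n + 1) - c n) :
    IsFolding (n + 1) (fun x => if x = n + 1 then 2 * c (n + 1) - c (n + 2) else c x)
      μ (fun x => if x = n + 1 then F (n + 2) else F x) e r := by
  have h0 : c (n + 1) < c (n + 2) := h.lt_succ (i := n + 1) (by omega)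
  refine h.init.shorten_last ?_ ?_ ?_
  all_goals
    rcases Nat.mod_two_eq_zero_or_one (n + e) with he | he
    · have e0 := h.sub_eq_of_even (i := n) (by omega) (by omega)
      have e1 := h.sub_eq_of_odd (i := n + 1) (by omega) (by omega)
      first
        | (intro _; constructor <;> linarith)
        | (rw [abs_of_pos] <;> linarith)
    · have e0 := h.sub_eq_of_odd (i := n) (by omega) (by omega)
      have e1 := h.sub_eq_of_even (i := n + 1) (by omega) (by omega)
      first
        | (intro _; constructor <;> linarith)
        | (rw [abs_of_neg] <;> linarith)

theorem exists_monocrimp (h : IsFolding (n + 2) c μ F e r) {j : ℕ} (hj : j < n)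
    (hl : c (j + 2) - c (j + 1) ≤ c (j + 1) - c j)
    (hr : c (j + 2) - c (j + 1) ≤ c (j + 3) - c (j + 2))
    (hμ : μ (j + 1) ≠ μ (j + 2)) :
    ∃ F' e' r', IsFolding n (monocrimpPattern c (j + 1))
      (fun x => if x < j + 1 then μ x else μ (x + 2)) F' e' r' := by
  have m0 := h.mv j (by omega)
  have m1 := h.mv (j + 1) (by omega)
  have hs : r j < r (j + 1) ↔ r (j + 1) < r (j + 2) := by
    rw [m0, m1]
    have : (j + 1 + e) % 2 = 0 ↔ ¬ (j + e) % 2 = 0 := by omega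
    rw [this]
    have hμ' : μ (j + 1) ≠ μ (j + 1 + 1) := hμ
    revert hμ'
    cases μ (j + 1) <;> cases μ (j + 1 + 1) <;> simp
  obtain ⟨R, merge, Rinj, sign, cross, taco⟩ := h.nonCrossing.exists_crimpRank (j := j) (by omega)
    (by rw [h.length j (by omega), h.length (j + 1) (by omega)]; exact hl)
    (by rw [h.length (j + 1) (by omega), h.length (j + 2) (by omega)]; exact hr) hs
  refine ⟨fun x => if x < j + 1 then F x else F (x + 2), e,
    fun x => if x < j + 1 then R x else R (x + 2), ?_⟩
  let s : ℕ → ℕ := fun i => if i < j then i else i + 2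
  set R' : ℕ → ℤ := fun x => if x < j + 1 then R x else R (x + 2) with hR'
  set F' : ℕ → ℝ := fun x => if x < j + 1 then F x else F (x + 2) with hF'
  have R0 : ∀ i, R' i = R (s i) := by
    intro i
    rcases lt_trichotomy i j with hi | rfl | hi
    · simp [R', s, hi, hi.le]
    · simp [R', s, merge]
    · simp [R', s, show ¬ i ≤ j by omega, show ¬ i < j by omega]
  have R1 : ∀ i, R' (i + 1) = R (s i + 1) := by
    intro i
    by_cases hi : i < j
    · simp [R', s, hi]
    · simp [R', s, hi, add_right_comm]
  have F1 : ∀ i, F' (i + 1) = F (s i + 1) := by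
    intro i
    by_cases hi : i < j
    · simp [F', s, hi]
    · simp [F', s, hi, add_right_comm]
  have F0 : ∀ i, i ≠ j → F' i = F (s i) := by
    intro i hij
    rcases lt_or_gt_of_ne hij with hi | hi
    · simp [F', s, hi, hi.le]
    · simp [F', s, show ¬ i ≤ j by omega, show ¬ i < j by omega]
  have Fj : F' j = F j := by simp [F']
  have Fj1 : F' (j + 1) = F (j + 3) := by simp [F']
  have s_add : ∀ i, (s i + e) % 2 = (i + e) % 2 := by
    intro i; simp only [s]; split <;> omega
  have s_mod : ∀ i, s i % 2 = i % 2 := by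
    intro i; simp only [s]; split <;> omega
  have s_lt : ∀ i, i < n → s i < n + 2 := by
    intro i hi; simp only [s]; split <;> omega
  have s_succ_lt : ∀ i, i + 1 < n → s i + 1 < n + 2 := by
    intro i hi; simp only [s]; split <;> omega
  have s_ne : ∀ i, s i ≠ j ∧ s i ≠ j + 1 := by
    intro i; simp only [s]; split <;> omega
  have B : ∀ i k, RankBetween R' i (i + 1) k ↔ RankBetween R (s i) (s i + 1) (s k) := by
    intro i k
    simp only [RankBetween, R0 i, R0 k, R1]
  have B1 : ∀ i k, RankBetween R' i (i + 1) (k + 1) ↔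
      RankBetween R (s i) (s i + 1) (s k + 1) := by
    intro i k
    simp only [RankBetween, R0 i, R1]
  have l0 := h.length j (by omega)
  have l1 := h.length (j + 1) (by omega)
  have l2 := h.length (j + 2) (by omega)
  have p0 := h.lt_succ (i := j) (by omega)
  have p1 := h.lt_succ (i := j + 1) (by omega)
  have p2 := h.lt_succ (i := j + 2) (by omega)
  have hup : (j + e) % 2 = 0 → F j < F (j + 3) ∧ F j ≤ F (j + 2) ∧ F (j + 2) < F (j + 1) ∧
      F (j + 1) ≤ F (j + 3) ∧ F (j + 3) - F j = c (j + 3) - c j - 2 * (c (j + 2) - c (j + 1)) := by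
    intro he
    have e0 := h.sub_eq_of_even (i := j) (by omega) (by omega)
    have e1 := h.sub_eq_of_odd (i := j + 1) (by omega) (by omega)
    have e2 := h.sub_eq_of_even (i := j + 2) (by omega) (by omega)
    refine ⟨?_, ?_, ?_, ?_, ?_⟩ <;> linarith
  have hdown : (j + e) % 2 = 1 → F (j + 3) < F j ∧ F (j + 2) ≤ F j ∧ F (j + 1) < F (j + 2) ∧
      F (j + 3) ≤ F (j + 1) ∧ F j - F (j + 3) = c (j + 3) - c j - 2 * (c (j + 2) - c (j + 1)) := by
    intro he
    have e0 := h.sub_eq_of_odd (i := j) (by omega) (by omega)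
    have e1 := h.sub_eq_of_even (i := j + 1) (by omega) (by omega)
    have e2 := h.sub_eq_of_odd (i := j + 2) (by omega) (by omega)
    refine ⟨?_, ?_, ?_, ?_, ?_⟩ <;> linarith
  refine ⟨⟨?_, ?_, ?_, ?_, ?_⟩, ?_, ?_⟩
  · intro i hi he
    by_cases hij : i = j
    · subst hij
      rw [Fj, Fj1]
      exact (hup he).1
    · rw [F0 i hij, F1]
      exact h.nonCrossing.up _ (s_lt i hi) (by rw [s_add, he])
  · intro i hi he
    by_cases hij : i = j
    · subst hij
      rw [Fj, Fj1]
      exact (hdown he).1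
    · rw [F0 i hij, F1]
      exact h.nonCrossing.down _ (s_lt i hi) (by rw [s_add, he])
  · intro a ha b hb hab
    rw [R0, R0] at hab
    have := Rinj _ (s_lt a ha) _ (s_lt b hb) (s_ne a).2 (s_ne b).2 hab
    have ha' := (s_ne a).1
    have hb' := (s_ne b).1
    have hs' : s a = s b := by tauto
    simp only [s] at hs'
    split at hs' <;> split at hs' <;> omega
  · intro i k hi hk hc
    rw [B]
    have cr := fun m hm hm' => cross (s i) m (s_succ_lt i hi) hm (s_ne i).1 (s_ne i).2 hm'
    by_cases hkj : k = j
    · subst hkj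
      have sk : s k = k + 2 := by simp [s]
      have hm : RankBetween R (s i) (s i + 1) k ↔ RankBetween R (s i) (s i + 1) (k + 2) := by
        simp only [RankBetween, merge]
      have c0 := cr k (by omega) (by omega)
      have c2 := cr (k + 2) (by omega) (by omega)
      rw [sk]
      rw [hm] at c0
      rw [Fj, Fj1, F1] at hc
      by_contra hb
      have c0' := fun hh => c0 hh hb
      have c2' := fun hh => c2 hh hb
      simp only [not_or, not_and, not_lt, imp_false] at c0' c2'
      rcases Nat.mod_two_eq_zero_or_one (k + e) with he | he
      · obtain ⟨u1, u2, u3, u4, -⟩ := hup he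
        rcases hc with hc | hc
        · have := c0'.1 hc.1
          have := c2'.1 (by linarith)
          linarith [hc.2]
        · linarith [hc.1, hc.2]
      · obtain ⟨u1, u2, u3, u4, -⟩ := hdown he
        rcases hc with hc | hc
        · linarith [hc.1, hc.2]
        · have := c2'.2 hc.1
          have := c0'.2 (by linarith)
          linarith [hc.2]
    · rw [F0 k hkj, F1, F1] at hc
      exact cr (s k) (s_lt k hk) (s_ne k).2 hc
  · intro i k hi hk hp hc
    rw [B, B1]
    rw [F1, F1] at hc
    exact taco _ _ (s_succ_lt i hi) (s_succ_lt k hk) (s_ne i).1 (s_ne i).2 (s_ne k).1 (s_ne k).2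
      (by rw [s_mod, s_mod, hp]) hc
  · intro i hi
    rcases lt_trichotomy i j with hij | rfl | hij
    · simpa [F', monocrimpPattern, hij, hij.le] using h.length i (by omega)
    · rw [Fj, Fj1]
      simp only [monocrimpPattern, lt_irrefl, if_false, Nat.lt_succ_self, if_true]
      change _ = c (i + 3) - 2 * (c (i + 2) - c (i + 1)) - c i
      rcases Nat.mod_two_eq_zero_or_one (i + e) with he | he
      · obtain ⟨u1, u2, u3, u4, u5⟩ := hup he
        rw [abs_of_pos] <;> linarith
      · obtain ⟨u1, u2, u3, u4, u5⟩ := hdown he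
        rw [abs_of_neg] <;> linarith
    · have := h.length (i + 2) (by omega)
      simp only [F', monocrimpPattern, show ¬ i < j + 1 by omega, show ¬ i + 1 < j + 1 by omega,
        if_false]
      rw [show i + 1 + 2 = i + 2 + 1 by ring, this]
      ring
  · intro i hi
    rw [R0, R1, sign _ (s_succ_lt i hi) (s_ne i).1 (s_ne i).2, h.mv _ (s_succ_lt i hi), s_add]
    have : μ (s i + 1) = if i + 1 < j + 1 then μ (i + 1) else μ (i + 1 + 2) := by
      by_cases hij : i < j
      · simp [s, hij]
      · simp [s, hij, add_right_comm]
    rw [this]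

/-- Two consecutive intervals point in opposite directions. -/
lemma sub_eq_and_sub_eq (h : IsFolding n c μ F e r) {i : ℕ} (hi : i + 1 < n) :
    (F (i + 1) - F i = c (i + 1) - c i ∧ F (i + 2) - F (i + 1) = -(c (i + 2) - c (i + 1))) ∨
    (F (i + 1) - F i = -(c (i + 1) - c i) ∧ F (i + 2) - F (i + 1) = c (i + 2) - c (i + 1)) := by
  rcases Nat.mod_two_eq_zero_or_one (i + e) with he | he
  · exact Or.inl ⟨h.sub_eq_of_even (by omega) he, h.sub_eq_of_odd (i := i + 1) hi (by omega)⟩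
  · exact Or.inr ⟨h.sub_eq_of_odd (by omega) he, h.sub_eq_of_even (i := i + 1) hi (by omega)⟩

lemma rank_ne (h : IsFolding n c μ F e r) {a b : ℕ} (ha : a < n) (hb : b < n) (hab : a ≠ b) :
    r a ≠ r b :=
  fun hr => hab (h.nonCrossing.inj a ha b hb hr)

lemma turn (h : IsFolding n c μ F e r) {i : ℕ} (hi : i + 2 < n) (hμ : μ (i + 1) = μ (i + 2)) :
    r i < r (i + 1) ↔ r (i + 2) < r (i + 1) := by
  have m1 := h.mv (i + 1) hi
  have hne := h.rank_ne (a := i + 1) (b := i + 2) (by omega) hi (by omega)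
  have hp : (i + 1 + e) % 2 = 0 ↔ ¬ (i + e) % 2 = 0 := by omega
  rw [hp, show i + 1 + 1 = i + 2 from rfl, ← hμ] at m1
  rw [h.mv i (by omega)]
  have : r (i + 2) < r (i + 1) ↔ ¬ r (i + 1) < r (i + 2) := by omega
  rw [this, m1]
  tauto

/-- A folding whose first and last intervals are longer than their neighbors admits a
monocrimp. -/
theorem exists_crimp (h : IsFolding n c μ F e r) (hn : 2 ≤ n)
    (hleft : c 2 - c 1 < c 1 - c 0) (hright : c (n - 1) - c (n - 2) < c n - c (n - 1)) :
    ∃ j, j + 2 < n ∧ c (j + 2) - c (j + 1) ≤ c (j + 1) - c j ∧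
      c (j + 2) - c (j + 1) ≤ c (j + 3) - c (j + 2) ∧ μ (j + 1) ≠ μ (j + 2) := by
  classical
  by_contra! hno
  have hmin : ∃ j, j < n ∧ ∀ i < n, c (j + 1) - c j ≤ c (i + 1) - c i := by
    obtain ⟨j, hj, hm⟩ := Finset.exists_min_image (Finset.range n) (fun i => c (i + 1) - c i)
      ⟨0, by simp; omega⟩
    exact ⟨j, by simpa using hj, fun i hi => hm i (by simpa using hi)⟩
  obtain ⟨hjn, hjmin⟩ := Nat.find_spec hmin
  have hjfirst : ∀ i < Nat.find hmin, _ := fun i hi => Nat.find_min hmin hi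
  generalize Nat.find hmin = j at hjn hjmin hjfirst
  set d := c (j + 1) - c j with hd
  have hlong : ∀ i < j, d < c (i + 1) - c i := by
    intro i hi
    refine lt_of_le_of_ne (hjmin i (by omega)) fun heq => hjfirst i hi ⟨by omega, ?_⟩
    rw [← heq]
    exact hjmin
  have hj0 : j ≠ 0 := by
    rintro rfl
    have := hjmin 1 (by omega)
    simp only [Nat.reduceAdd] at this hd
    linarith
  have hend : d < c n - c (n - 1) := by
    have := hjmin (n - 2) (by omega)
    rw [show n - 2 + 1 = n - 1 by omega] at this
    linarith
  have hex : ∃ k, j < k ∧ k < n ∧ c (k + 1) - c k ≠ d := by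
    refine ⟨n - 1, ?_, by omega, ?_⟩
    · have : j ≠ n - 1 := by
        rintro rfl
        rw [show n - 1 + 1 = n by omega] at hd
        exact absurd hend (by rw [hd]; exact lt_irrefl _)
      omega
    · rw [show n - 1 + 1 = n by omega]
      exact hend.ne'
  obtain ⟨hjk, hkn, hk⟩ := Nat.find_spec hex
  have hkfirst : ∀ i < Nat.find hex, _ := fun i hi => Nat.find_min hex hi
  generalize Nat.find hex = k at hjk hkn hk hkfirst
  have hkd : d < c (k + 1) - c k := lt_of_le_of_ne (hjmin k hkn) hk.symm
  have hshort : ∀ i, j ≤ i → i < k → c (i + 1) - c i = d := by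
    intro i hi hik
    by_contra hne
    refine hkfirst i hik ⟨lt_of_le_of_ne hi ?_, by omega, hne⟩
    rintro rfl
    exact hne rfl
  obtain ⟨a, rfl⟩ : ∃ a, j = a + 1 := ⟨j - 1, by omega⟩
  have hμ : ∀ i, a ≤ i → i + 1 < k → μ (i + 1) = μ (i + 2) := by
    intro i hi hik
    have hi1 := hshort (i + 1) (by omega) hik
    refine hno i (by omega) ?_ ?_
    · exact hi1.le.trans (hjmin i (by omega))
    · exact hi1.le.trans (hjmin (i + 2) (by omega))
  have spiral : ∀ t, a + t + 2 ≤ k → RankBetween r (a + t) (a + t + 1) (a + t + 2) := by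
    intro t
    induction t with
    | zero =>
      intro ht
      have T := h.turn (i := a) (by omega) (hμ a le_rfl (by omega))
      have n1 := h.rank_ne (a := a) (b := a + 1) (by omega) (by omega) (by omega)
      have n2 := h.rank_ne (a := a) (b := a + 2) (by omega) (by omega) (by omega)
      have n3 := h.rank_ne (a := a + 1) (b := a + 2) (by omega) (by omega) (by omega)
      have X : ¬ RankBetween r (a + 1) (a + 1 + 1) a := by
        apply h.nonCrossing.cross (a + 1) a (by omega) (by omega)
        have l0 := hlong a (by omega)
        have p1 := h.lt_succ (i := a + 1) (by omega)
        change (F a < F (a + 2) ∧ F (a + 2) < _) ∨ (_ < F (a + 2) ∧ F (a + 2) < F a)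
        rcases h.sub_eq_and_sub_eq (i := a) (by omega) with ⟨e0, e1⟩ | ⟨e0, e1⟩
        · left; constructor <;> linarith
        · right; constructor <;> linarith
      simp only [RankBetween, add_assoc, Nat.reduceAdd, add_zero] at X ⊢
      omega
    | succ t ih =>
      intro ht
      have B := ih (by omega)
      have hF : F (a + t + 1) = F (a + t + 2 + 1) := by
        have l1 := hshort (a + t + 1) (by omega) (by omega)
        have l2 := hshort (a + t + 2) (by omega) (by omega)
        rcases h.sub_eq_and_sub_eq (i := a + t + 1) (by omega) with ⟨e0, e1⟩ | ⟨e0, e1⟩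
        · change F (a + t + 1) = F (a + t + 1 + 2)
          change c (a + t + 1 + 2) - _ = _ at l2
          linarith
        · change F (a + t + 1) = F (a + t + 1 + 2)
          change c (a + t + 1 + 2) - _ = _ at l2
          linarith
      have B' := (h.nonCrossing.taco (a + t) (a + t + 2) (by omega) (by omega) (by omega) hF).1 B
      have T := h.turn (i := a + t + 1) (by omega) (hμ (a + t + 1) (by omega) (by omega))
      have n := h.rank_ne (a := a + t + 2) (b := a + t + 3) (by omega) (by omega) (by omega)
      simp only [RankBetween, add_assoc, Nat.reduceAdd] at B B' T n ⊢
      omega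
  obtain ⟨t, rfl⟩ : ∃ t, k = a + t + 2 := ⟨k - 2 - a, by omega⟩
  refine h.nonCrossing.cross (a + t) (a + t + 2) (by omega) hkn ?_ (spiral t le_rfl)
  have l1 := hshort (a + t + 1) (by omega) (by omega)
  have p1 := h.lt_succ (i := a + t + 1) (by omega)
  rcases h.sub_eq_and_sub_eq (i := a + t + 1) (by omega) with ⟨e0, e1⟩ | ⟨e0, e1⟩
  · right
    constructor <;> linarith
  · left
    constructor <;> linarith

lemma congr {c' : ℕ → ℝ} (h : IsFolding n c μ F e r) (hc : ∀ i ≤ n, c' i = c i) :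
    IsFolding n c' μ F e r :=
  ⟨h.nonCrossing, fun i hi => by rw [h.length i hi, hc i (by omega), hc (i + 1) (by omega)], h.mv⟩

/-- A folding with a crease admits a sequence of steps leading to a crease-free
pattern or to a folding with fewer creases. -/
theorem exists_smaller (h : IsFolding n c μ F e r) (hn : 2 ≤ n) :
    ∃ n' c' μ', 1 ≤ n' ∧ n' < n ∧
      Relation.ReflTransGen FoldStep (n, c, μ) (n', c', μ') ∧
      (n' = 1 ∨ ∃ F' e' r', IsFolding n' c' μ' F' e' r') := by
  rcases lt_trichotomy (c 1 - c 0) (c 2 - c 1) with hl | hl | hl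
  · obtain ⟨m, rfl⟩ : ∃ m, n = m + 2 := ⟨n - 2, by omega⟩
    exact ⟨m + 1, _, _, by omega, by omega, .single (FoldStep.endLeft (m + 2) c μ hn hl.le),
      .inr ⟨_, _, _, h.endLeft hl⟩⟩
  · have h1 := FoldStep.endLeft n c μ hn hl.le
    rcases Nat.lt_or_ge 2 n with h3 | h3
    · obtain ⟨m, rfl⟩ : ∃ m, n = m + 3 := ⟨n - 3, by omega⟩
      refine ⟨m + 1, _, _, by omega, by omega,
        .tail (.single h1) (FoldStep.endLeft (m + 2) _ _ (by omega) ?_),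
        .inr ⟨_, _, _, h.tail.tail.congr ?_⟩⟩
      · have := h.lt_succ (i := 2) (by omega)
        simp only [one_ne_zero, if_false, if_true, Nat.reduceAdd, OfNat.ofNat_ne_zero] at this ⊢
        linarith
      · intro i hi
        rcases Nat.eq_zero_or_pos i with rfl | hi
        · simp only [one_ne_zero, if_false, if_true, Nat.reduceAdd]
          linarith
        · simp [hi.ne']
    · obtain rfl : n = 2 := by omega
      exact ⟨1, _, _, le_rfl, by omega, .single h1, .inl rfl⟩
  · rcases lt_trichotomy (c n - c (n - 1)) (c (n - 1) - c (n - 2)) with hr | hr | hr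
    · obtain ⟨m, rfl⟩ : ∃ m, n = m + 2 := ⟨n - 2, by omega⟩
      exact ⟨m + 1, _, _, by omega, by omega, .single (FoldStep.endRight (m + 2) c μ hn hr.le),
        .inr ⟨_, _, _, h.endRight hr⟩⟩
    · have h3 : n ≠ 2 := by
        rintro rfl
        simp only [Nat.reduceSub] at hr
        linarith
      obtain ⟨m, rfl⟩ : ∃ m, n = m + 3 := ⟨n - 3, by omega⟩
      have h1 := FoldStep.endRight (m + 3) c μ hn hr.le
      simp only [show m + 3 - 1 = m + 2 from rfl,
        show m + 3 - 2 = m + 1 from rfl] at h1 hr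
      refine ⟨m + 1, _, _, by omega, by omega,
        .tail (.single h1) (FoldStep.endRight (m + 2) _ _ (by omega) ?_),
        .inr ⟨_, _, _, h.init.init.congr ?_⟩⟩
      · have := h.lt_succ (i := m) (by omega)
        simp
        linarith
      · intro i hi
        rcases hi.lt_or_eq with hi | rfl
        · simp [hi.ne, show i ≠ m + 2 by omega]
        · simp
          linarith
    · obtain ⟨j, hj, h1, h2, hμ⟩ := h.exists_crimp hn hl hr
      obtain ⟨m, rfl⟩ : ∃ m, n = m + 2 := ⟨n - 2, by omega⟩
      exact ⟨m, _, _, by omega, by omega,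
        .single (FoldStep.mono (m + 2) c μ (j + 1) (by omega) (by omega) h1 h2 hμ),
        .inr (h.exists_monocrimp (by omega) h1 h2 hμ)⟩

theorem exists_reduction (h : IsFolding n c μ F e r) (hn : 1 ≤ n) :
    ∃ c' μ', Relation.ReflTransGen FoldStep (n, c, μ) (1, c', μ') := by
  induction n using Nat.strong_induction_on generalizing c μ F e r with
  | _ n ih =>
    rcases hn.eq_or_lt with rfl | hn2
    · exact ⟨c, μ, .refl⟩
    · obtain ⟨n', c', μ', hn', hlt, hsteps, rfl | ⟨F', e', r', h'⟩⟩ := h.exists_smaller hn2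
      · exact ⟨c', μ', hsteps⟩
      · obtain ⟨c'', μ'', hrest⟩ := ih n' hlt h' hn'
        exact ⟨c'', μ'', hsteps.trans hrest⟩

end IsFolding

/-- Any flat folding of a foldable 1D crease pattern can be performed by a finite
sequence of monocrimps and end folds: a flat-foldable MV pattern can be reduced by
such steps to a crease pattern with no creases (`n = 1`). -/
theorem foldable_reduces_by_crimps_and_end_folds (n : ℕ) (c : ℕ → ℝ) (μ : ℕ → MV)
    (hC : IsCreasePattern n c) (hF : IsFlatFoldable n c μ) :
    ∃ (c' : ℕ → ℝ) (μ' : ℕ → MV),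
      Relation.ReflTransGen FoldStep (n, c, μ) (1, c', μ') := by
  obtain ⟨F, e, r, h⟩ := hF.exists_isFolding hC
  exact h.exists_reduction hC.1
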